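/- (Edge-to-vertex expansion) Let X be a finite simple s-regular graph with spectral bound λ₂ (0 ≤ λ₂ < s), let α > 0, and let E ⊆ E(X) be a set of edges with |E| ≤ α·|E(X)|. Then |Γ(E)| ≥ β·|E|, where β = (√(λ₂² + 4s(s−λ₂)α) − λ₂) / (s·(s−λ₂)·α). -/

import Mathlib

open Finset in
/-- Twice the number of edges, as a sum of adjacency indicators. -/
theorem SimpleGraph.sum_adj_eq_twice_ncard_edgeSet {V : Type*} [Fintype V] (H : SimpleGraph V)
    [DecidableRel H.Adj] :
    (∑ u, ∑ v, if H.Adj u v then (1 : ℝ) else 0) = 2 * H.edgeSet.ncard := by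
  classical
  have h := H.sum_degrees_eq_twice_card_edges
  have hc : H.edgeSet.ncard = #H.edgeFinset := by
    rw [← SimpleGraph.coe_edgeFinset, Set.ncard_coe_finset]
  rw [hc]
  have h' : ((∑ v, H.degree v : ℕ) : ℝ) = 2 * (#H.edgeFinset : ℝ) := by
    rw [h]; push_cast; ring
  rw [← h', Nat.cast_sum]
  refine sum_congr rfl fun u _ => ?_
  rw [sum_boole, ← SimpleGraph.card_neighborFinset_eq_degree, SimpleGraph.neighborFinset_eq_filter]

/-- In a regular graph, the adjacency indicators of each row sum to the degree. -/
theorem SimpleGraph.IsRegularOfDegree.sum_adj {V : Type*} [Fintype V] {G : SimpleGraph V}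
    [DecidableRel G.Adj] {s : ℕ} (hreg : G.IsRegularOfDegree s) (u : V) :
    (∑ v, if G.Adj u v then (1 : ℝ) else 0) = s := by
  classical
  rw [Finset.sum_boole, ← hreg u, ← SimpleGraph.card_neighborFinset_eq_degree,
    SimpleGraph.neighborFinset_eq_filter]

/-- The expander mixing bound for the quadratic form of the adjacency matrix. -/
theorem SimpleGraph.IsRegularOfDegree.sum_adj_mul_le {V : Type*} [Fintype V] [Nonempty V]
    {G : SimpleGraph V} [DecidableRel G.Adj] {s : ℕ} (hreg : G.IsRegularOfDegree s) {l : ℝ}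
    (hspec : ∀ f : V → ℝ, (∑ v, f v) = 0 →
      (∑ u, ∑ v, if G.Adj u v then f u * f v else 0) ≤ l * ∑ v, (f v) ^ 2) (i : V → ℝ) :
    (∑ u, ∑ v, if G.Adj u v then i u * i v else 0) ≤
      l * ∑ v, i v ^ 2 + (s - l) * (∑ v, i v) ^ 2 / Fintype.card V := by
  have hn : (Fintype.card V : ℝ) ≠ 0 := by exact_mod_cast Fintype.card_ne_zero
  set n := (Fintype.card V : ℝ)
  set g := ∑ v, i v with hg
  set c := g / n with hc
  have hcn : c * n = g := div_mul_cancel₀ _ hn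
  have hsum : (∑ v, (i v - c)) = 0 := by
    rw [Finset.sum_sub_distrib, Finset.sum_const, nsmul_eq_mul, Finset.card_univ]
    linarith
  have h := hspec _ hsum
  have hrow : (∑ u, ∑ v, if G.Adj u v then i u else 0) = s * g := by
    rw [hg, Finset.mul_sum]
    refine Finset.sum_congr rfl fun u _ => ?_
    rw [← hreg.sum_adj u, Finset.sum_mul]
    exact Finset.sum_congr rfl fun v _ => by simp
  have hcol : (∑ u, ∑ v, if G.Adj u v then i v else 0) = s * g := by
    rw [Finset.sum_comm, ← hrow]
    simp only [G.adj_comm]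
  have hall : (∑ u, ∑ v, if G.Adj u v then (1 : ℝ) else 0) = s * n := by
    simp only [hreg.sum_adj, Finset.sum_const, nsmul_eq_mul, Finset.card_univ]
    ring
  have hL : (∑ u, ∑ v, if G.Adj u v then (i u - c) * (i v - c) else 0) =
      (∑ u, ∑ v, if G.Adj u v then i u * i v else 0) - c * (s * g) - c * (s * g)
        + c ^ 2 * (s * n) := by
    conv_rhs => rw [← hall]
    nth_rewrite 1 [← hrow]
    rw [← hcol]
    simp only [Finset.mul_sum, ← Finset.sum_sub_distrib, ← Finset.sum_add_distrib]
    refine Finset.sum_congr rfl fun u _ => Finset.sum_congr rfl fun v _ => ?_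
    split_ifs <;> ring
  have hR : (∑ v, (i v - c) ^ 2) = (∑ v, i v ^ 2) - 2 * c * g + c ^ 2 * n := by
    have hconst : c ^ 2 * n = ∑ _v : V, c ^ 2 := by
      rw [Finset.sum_const, nsmul_eq_mul, Finset.card_univ]; ring
    rw [hconst, hg, Finset.mul_sum, ← Finset.sum_sub_distrib, ← Finset.sum_add_distrib]
    exact Finset.sum_congr rfl fun v _ => by ring
  rw [hL, hR] at h
  have hsq : c ^ 2 * n = c * g := by rw [← hcn]; ring
  have hq : (s - l) * g ^ 2 / n = (s - l) * (c * g) := by rw [hc]; ring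
  rw [hq]
  have hs : c ^ 2 * (s * n) = s * (c * g) := by rw [← hsq]; ring
  rw [hs, hsq] at h
  linarith

/-- A nonnegative `g` with `A g² + 2 l g e ≥ 4 e²` is at least the positive root. -/
theorem root_mul_le_of_quadratic {A l e g : ℝ} (hA : 0 < A) (hl : 0 ≤ l) (he : 0 ≤ e)
    (hg : 0 ≤ g) (h : 4 * e ^ 2 ≤ 2 * l * g * e + A * g ^ 2) :
    (√(l ^ 2 + 4 * A) - l) / A * e ≤ g := by
  rw [div_mul_eq_mul_div, div_le_iff₀ hA]
  have hkey : √(l ^ 2 + 4 * A) * e ≤ g * A + l * e := by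
    refine abs_le_of_sq_le_sq' ?_ (by positivity) |>.2
    rw [mul_pow, Real.sq_sqrt (by positivity)]
    nlinarith [mul_le_mul_of_nonneg_left h hA.le]
  linarith


/-- Edge-to-vertex expansion: if `E` is a set of edges of an `s`-regular spectral
expander with `|E| ≤ α·|E(X)|`, then the set `Γ(E)` of vertices incident to an
edge of `E` satisfies `|Γ(E)| ≥ β·|E|` with
`β = (√(λ₂² + 4s(s−λ₂)α) − λ₂)/(s(s−λ₂)α)`. -/
theorem edge_to_vertex_expansion
    {V : Type} [Fintype V] (G : SimpleGraph V) [DecidableRel G.Adj]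
    (s : ℕ) (hreg : G.IsRegularOfDegree s)
    (l2 : ℝ) (hl2_nonneg : 0 ≤ l2) (hl2_lt : l2 < s)
    (hspec : ∀ f : V → ℝ, (∑ v, f v) = 0 →
      (∑ u, ∑ v, if G.Adj u v then f u * f v else 0) ≤ l2 * ∑ v, (f v) ^ 2)
    (α : ℝ) (hα : 0 < α)
    (E : Set (Sym2 V)) (hE : E ⊆ G.edgeSet)
    (hEcard : (E.ncard : ℝ) ≤ α * G.edgeSet.ncard) :
    (Real.sqrt (l2 ^ 2 + 4 * s * ((s : ℝ) - l2) * α) - l2) / (s * ((s : ℝ) - l2) * α)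
        * E.ncard
      ≤ (({v : V | ∃ e ∈ E, v ∈ e} : Set V).ncard : ℝ) := by
  classical
  have hs : (0 : ℝ) < s := hl2_nonneg.trans_lt hl2_lt
  have hd : 0 < (s : ℝ) - l2 := sub_pos.2 hl2_lt
  rcases isEmpty_or_nonempty V with hV | hV
  · simp [Set.eq_empty_of_isEmpty E]
  have hn : (0 : ℝ) < Fintype.card V := by exact_mod_cast Fintype.card_pos
  set S : Set V := {v : V | ∃ e ∈ E, v ∈ e} with hS
  let i : V → ℝ := S.indicator 1
  have hi : ∀ v, i v = if v ∈ S then 1 else 0 := fun v => by simp [i, Set.indicator_apply]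
  have hi1 : ∑ v, i v = S.ncard := by
    rw [Finset.sum_congr rfl fun v _ => hi v, Finset.sum_boole, ← Set.ncard_coe_finset]
    simp
  have hi2 : ∑ v, i v ^ 2 = S.ncard := by
    rw [← hi1]
    exact Finset.sum_congr rfl fun v _ => by rw [hi]; split_ifs <;> norm_num
  have hmix := hreg.sum_adj_mul_le hspec i
  rw [hi1, hi2] at hmix
  have hGcard : 2 * (G.edgeSet.ncard : ℝ) = s * Fintype.card V := by
    rw [← G.sum_adj_eq_twice_ncard_edgeSet]
    simp only [hreg.sum_adj, Finset.sum_const, nsmul_eq_mul, Finset.card_univ]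
    ring
  have hHE : (SimpleGraph.fromEdgeSet E).edgeSet = E := by
    rw [SimpleGraph.edgeSet_fromEdgeSet]
    exact sdiff_eq_left.2 (Set.disjoint_left.2 fun e he hdiag =>
      G.not_isDiag_of_mem_edgeSet (hE he) hdiag)
  have hEle : 2 * (E.ncard : ℝ) ≤ ∑ u, ∑ v, if G.Adj u v then i u * i v else 0 := by
    have h := (SimpleGraph.fromEdgeSet E).sum_adj_eq_twice_ncard_edgeSet
    rw [hHE] at h
    rw [← h]
    refine Finset.sum_le_sum fun u _ => Finset.sum_le_sum fun v _ => ?_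
    by_cases huv : s(u, v) ∈ E
    · have hG : G.Adj u v := hE huv
      have hu : u ∈ S := ⟨_, huv, Sym2.mem_mk_left u v⟩
      have hv : v ∈ S := ⟨_, huv, Sym2.mem_mk_right u v⟩
      simp [hi, hu, hv, hG, huv, hG.ne]
    · simp only [SimpleGraph.fromEdgeSet_adj, huv, false_and, if_false, hi]
      split_ifs <;> norm_num
  have hbound : 2 * (E.ncard : ℝ) ≤ α * (s * Fintype.card V) := by
    rw [← hGcard]; linarith
  have h2 := hEle.trans hmix
  have he : (0 : ℝ) ≤ E.ncard := Nat.cast_nonneg _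
  have hg : (0 : ℝ) ≤ S.ncard := Nat.cast_nonneg _
  rw [show 4 * (s : ℝ) * (s - l2) * α = 4 * (s * (s - l2) * α) by ring]
  refine root_mul_le_of_quadratic (by positivity) hl2_nonneg he hg ?_
  have hdiv : 2 * (E.ncard : ℝ) * ((s - l2) * (S.ncard : ℝ) ^ 2 / Fintype.card V) ≤
      s * (s - l2) * α * (S.ncard : ℝ) ^ 2 := by
    rw [mul_div_assoc', div_le_iff₀ hn]
    have := mul_le_mul_of_nonneg_right hbound
      (mul_nonneg hd.le (sq_nonneg (S.ncard : ℝ)))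
    linarith
  have := mul_le_mul_of_nonneg_left h2 (by positivity : (0 : ℝ) ≤ 2 * E.ncard)
  linarith
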